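/- Let 𝒳 ⊂ ℝ^d be a compact set, and consider the set 𝒮 of all functions u : 𝒳 → ℝ of the form u = 𝔑 ∘ (Id + ψ_L) ∘ ⋯ ∘ (Id + ψ₁) ∘ 𝔏 for some L ∈ ℕ, where 𝔏 : ℝ^d → ℝ^{d+1}, 𝔏(x) = (0, x), 𝔑 : ℝ^{d+1} → ℝ, 𝔑(y) = y₁, and each ψ_k : ℝ^{d+1} → ℝ^{d+1} admits a tensor-train representation with affine factors and ranks bounded by (d+1, 2, 2, …, 2, 1). Then 𝒮 is dense in C(𝒳; ℝ) equipped with the supremum norm: for every continuous f : 𝒳 → ℝ and every ε > 0 there exists u ∈ 𝒮 with sup_{x∈𝒳} |f(x) − u(x)| ≤ ε. -/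

import Mathlib

noncomputable def ttProdAux {d : ℕ} (r : Fin (d + 1) → ℕ)
    (U : ∀ i : Fin d, Matrix (Fin (r i.castSucc)) (Fin (r i.succ)) ℝ) :
    ∀ k : Fin (d + 1), Matrix (Fin (r 0)) (Fin (r k)) ℝ :=
  Fin.induction (motive := fun k => Matrix (Fin (r 0)) (Fin (r k)) ℝ) 1
    fun i acc => acc * U i

noncomputable def ttProd {d : ℕ} (r : Fin (d + 1) → ℕ)
    (U : ∀ i : Fin d, Matrix (Fin (r i.castSucc)) (Fin (r i.succ)) ℝ) :
    Matrix (Fin (r 0)) (Fin (r (Fin.last d))) ℝ :=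
  ttProdAux r U (Fin.last d)

def AffineEntry (f : ℝ → ℝ) : Prop := ∃ a b : ℝ, ∀ t, f t = a * t + b

def AffineFactor {m n : ℕ} (U : ℝ → Matrix (Fin m) (Fin n) ℝ) : Prop :=
  ∀ i j, AffineEntry fun t => U t i j

/-- ψ : ℝ^p → ℝ^p has a TT representation with affine factors, first rank p, last
rank 1 and internal ranks bounded by bnd. -/
def HasTTAffine (p : ℕ) (ψ : (Fin p → ℝ) → Fin p → ℝ) (bnd : ℕ) : Prop :=
  ∃ (r : Fin (p + 1) → ℕ) (h0 : r 0 = p),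
    r (Fin.last p) = 1 ∧
    (∀ k : Fin (p + 1), k ≠ 0 → k ≠ Fin.last p → r k ≤ bnd) ∧
    ∃ U : ∀ i : Fin p, ℝ → Matrix (Fin (r i.castSucc)) (Fin (r i.succ)) ℝ,
      (∀ i, AffineFactor (U i)) ∧
      ∀ y : Fin p → ℝ, ∀ (i : Fin (r 0)) (j : Fin (r (Fin.last p))),
        ttProd r (fun k => U k (y k)) i j = ψ y (Fin.cast h0 i)

theorem ttProdAux_succ {d : ℕ} (r : Fin (d + 1) → ℕ)
    (U : ∀ i : Fin d, Matrix (Fin (r i.castSucc)) (Fin (r i.succ)) ℝ) (k : Fin d) :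
    ttProdAux r U k.succ = ttProdAux r U k.castSucc * U k :=
  Fin.induction_succ ..

/-- A map `y ↦ (eᵢ ∏ₖ aₖ(yₖ))ᵢ` with affine functions `aₖ` has a rank-one tensor train
representation. -/
theorem hasTTAffine_of_eq_mul_prod {n b : ℕ} (hb : 1 ≤ b) (e : Fin (n + 1) → ℝ)
    (a : Fin (n + 1) → ℝ → ℝ) (ha : ∀ k, AffineEntry (a k)) :
    HasTTAffine (n + 1) (fun y i => e i * ∏ k, a k (y k)) b := by
  let r : Fin (n + 1 + 1) → ℕ := fun k => if k = 0 then n + 1 else 1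
  have h0 : r 0 = n + 1 := if_pos rfl
  have hr : ∀ k, k ≠ 0 → r k = 1 := fun k hk => if_neg hk
  let U : ∀ i : Fin (n + 1), ℝ → Matrix (Fin (r i.castSucc)) (Fin (r i.succ)) ℝ :=
    fun i t => Matrix.of fun l _ =>
      (if i = 0 then (if h : l.val < n + 1 then e ⟨l.val, h⟩ else 0) else 1) * a i t
  refine ⟨r, h0, hr _ (Fin.last_pos.ne'), fun k hk _ => (hr k hk).trans_le hb, U, ?_, ?_⟩
  · intro i l m
    obtain ⟨s, c, h⟩ := ha i
    refine ⟨(if i = 0 then (if h : l.val < n + 1 then e ⟨l.val, h⟩ else 0) else 1) * s,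
      (if i = 0 then (if h : l.val < n + 1 then e ⟨l.val, h⟩ else 0) else 1) * c, fun t => ?_⟩
    simp only [U, Matrix.of_apply, h]
    ring
  · intro y i j
    have key : ∀ k : Fin (n + 1), ∀ (i : Fin (r 0)) (j : Fin (r k.succ)),
        ttProdAux r (fun k => U k (y k)) k.succ i j =
          e (Fin.cast h0 i) * ∏ m ∈ Finset.Iic k, a m (y m) := by
      intro k
      induction k using Fin.induction with
      | zero =>
        intro i j
        have hI : Finset.Iic (0 : Fin (n + 1)) = {0} := by
          ext m; simp
        rw [hI, Finset.prod_singleton]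
        have hone : ∀ l : Fin (r 0), ttProdAux r (fun k => U k (y k)) (Fin.castSucc 0) i l =
          (1 : Matrix (Fin (r 0)) (Fin (r 0)) ℝ) i l := fun _ => rfl
        rw [ttProdAux_succ, Matrix.mul_apply]
        refine (Finset.sum_eq_single (ι := Fin (r 0)) i (fun l _ hl => ?_)
          (fun h => absurd (Finset.mem_univ _) h)).trans ?_
        · rw [hone, Matrix.one_apply_ne hl.symm, zero_mul]
        · rw [hone, Matrix.one_apply_eq, one_mul]
          change (if (0 : Fin (n + 1)) = 0 then
            (if h : i.val < n + 1 then e ⟨i.val, h⟩ else 0) else 1) * a 0 (y 0) = _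
          rw [if_pos rfl, dif_pos (show i.val < n + 1 from (Fin.cast h0 i).isLt)]
          rfl
      | succ k ih =>
        intro i j
        have hI : Finset.Iic k.succ = insert k.succ (Finset.Iic k.castSucc) := by
          ext m
          simp only [Finset.mem_Iic, Finset.mem_insert, Fin.le_def, Fin.ext_iff, Fin.val_succ,
            Fin.val_castSucc]
          omega
        rw [hI, Finset.prod_insert (by simp [Fin.le_def])]
        rw [ttProdAux_succ, Matrix.mul_apply]
        have h1 : r k.succ.castSucc = 1 := hr _ (Fin.succ_ne_zero k.castSucc)
        have : Subsingleton (Fin (r k.succ.castSucc)) := by rw [h1]; infer_instance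
        rw [Fintype.sum_subsingleton _ (Fin.cast h1.symm 0)]
        refine (congrArg (· * _) (ih i (Fin.cast h1.symm 0))).trans ?_
        simp only [U, Matrix.of_apply, Fin.succ_ne_zero, if_false]
        ring
    have hI : Finset.Iic (Fin.last n) = Finset.univ := by
      ext m; simp [Fin.le_last]
    have := key (Fin.last n) i j
    rw [hI] at this
    exact this

/-- The continuous functions `u` on `X` for which `(0, x) ↦ (u x, x)` is exactly a composition of
residual layers `y ↦ y + ψ y` with affine tensor trains `ψ` of internal ranks at most `2`. -/
def ttReachable {d : ℕ} (X : Set (Fin d → ℝ)) : Set C(X, ℝ) :=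
  {u | ∃ (L : ℕ) (ψ : ℕ → (Fin (d + 1) → ℝ) → Fin (d + 1) → ℝ),
    (∀ ℓ < L, HasTTAffine (d + 1) (ψ ℓ) 2) ∧
    ∀ x : X, (List.range L).foldl (fun y ℓ => y + ψ ℓ y)
      (Fin.cons 0 x.1 : Fin (d + 1) → ℝ) = Fin.cons (u x) x.1}

section Reachable

variable {d : ℕ} {X : Set (Fin d → ℝ)}

theorem zero_mem_ttReachable : (0 : C(X, ℝ)) ∈ ttReachable X :=
  ⟨0, fun _ => 0, by simp, by simp⟩

theorem ttReachable_of_layer {u v : C(X, ℝ)} (hu : u ∈ ttReachable X)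
    (φ : (Fin (d + 1) → ℝ) → Fin (d + 1) → ℝ) (hφ : HasTTAffine (d + 1) φ 2)
    (h : ∀ x : X, (Fin.cons (u x) x.1 : Fin (d + 1) → ℝ) + φ (Fin.cons (u x) x.1) =
      Fin.cons (v x) x.1) : v ∈ ttReachable X := by
  obtain ⟨L, ψ, hψ, hL⟩ := hu
  refine ⟨L + 1, Function.update ψ L φ, fun ℓ hℓ => ?_, fun x => ?_⟩
  · rcases eq_or_ne ℓ L with rfl | hne
    · simpa using hφ
    · rw [Function.update_of_ne hne]
      exact hψ ℓ (by omega)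
  · rw [List.range_succ, List.foldl_append, List.foldl_ext (l := List.range L) _ (fun y ℓ => y + ψ ℓ y), hL x]
    · simpa using h x
    · intro y ℓ hℓ
      rw [Function.update_of_ne (List.mem_range.1 hℓ).ne]

theorem add_const_mem_ttReachable {u : C(X, ℝ)} (hu : u ∈ ttReachable X) (c : ℝ) :
    u + ContinuousMap.const X c ∈ ttReachable X := by
  refine ttReachable_of_layer hu _ (hasTTAffine_of_eq_mul_prod one_le_two
    (Fin.cons c 0) (fun _ _ => 1) fun _ => ⟨0, 1, by simp⟩) fun x => ?_
  ext i
  refine Fin.cases ?_ (fun j => ?_) i <;> simp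

theorem mul_one_add_mem_ttReachable {u : C(X, ℝ)} (hu : u ∈ ttReachable X) (i : Fin d) (t : ℝ)
    {w : C(X, ℝ)} (hw : ∀ x : X, w x = 1 + t * x.1 i) : u * w ∈ ttReachable X := by
  refine ttReachable_of_layer hu _ (hasTTAffine_of_eq_mul_prod one_le_two
    (Fin.cons t 0) (Fin.cons id fun j s => if j = i then s else 1) fun k => ?_) fun x => ?_
  · refine Fin.cases ⟨1, 0, by simp⟩ (fun j => ?_) k
    by_cases hj : j = i
    · exact ⟨1, 0, by simp [hj]⟩
    · exact ⟨0, 1, by simp [hj]⟩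
  · ext k
    refine Fin.cases ?_ (fun j => ?_) k
    · simp [Fin.prod_univ_succ, hw]
      ring
    · simp

theorem abs_one_add_div_pow_sub_exp_le {a M : ℝ} {n : ℕ} (hn : 0 < n) (ha : |a| ≤ M)
    (hM : M ≤ n) : |(1 + a / n) ^ n - Real.exp a| ≤ M ^ 2 * Real.exp M / n := by
  have hn' : (0 : ℝ) < n := by exact_mod_cast hn
  have hM0 : 0 ≤ M := (abs_nonneg a).trans ha
  have hs : |a / n| ≤ M / n := by
    rw [abs_div, abs_of_pos hn']
    gcongr
  have hs1 : |a / n| ≤ 1 := hs.trans ((div_le_one hn').2 hM)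
  have hexp : Real.exp a = Real.exp (a / n) ^ n := by
    rw [← Real.exp_nat_mul]
    congr 1
    field_simp
  have h1 : |(1 + a / n) - Real.exp (a / n)| ≤ (M / n) ^ 2 := by
    rw [abs_sub_comm, ← sub_sub]
    refine (Real.abs_exp_sub_one_sub_id_le hs1).trans ?_
    rw [← sq_abs]
    gcongr
  have h2 : max |1 + a / n| |Real.exp (a / n)| ≤ Real.exp (M / n) := by
    refine max_le ?_ ?_
    · refine (abs_add_le _ _).trans ?_
      rw [abs_one, add_comm]
      exact (add_le_add_left hs 1).trans (Real.add_one_le_exp _)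
    · rw [Real.abs_exp]
      exact Real.exp_le_exp.2 ((le_abs_self _).trans hs)
  rw [hexp]
  calc |(1 + a / n) ^ n - Real.exp (a / n) ^ n|
      ≤ |(1 + a / n) - Real.exp (a / n)| * n * max |1 + a / n| |Real.exp (a / n)| ^ (n - 1) :=
        abs_pow_sub_pow_le ..
    _ ≤ (M / n) ^ 2 * n * Real.exp (M / n) ^ n := by
        gcongr
        refine (pow_le_pow_left₀ (by positivity) h2 _).trans ?_
        exact pow_le_pow_right₀ (Real.one_le_exp (by positivity)) (Nat.sub_le _ _)
    _ = M ^ 2 * Real.exp M / n := by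
        rw [← Real.exp_nat_mul]
        have : (n : ℝ) * (M / n) = M := by field_simp
        rw [this]
        field_simp

theorem tendsto_one_add_div_pow_continuousMap {Y : Type*} [TopologicalSpace Y] [CompactSpace Y]
    (a : C(Y, ℝ)) :
    Filter.Tendsto (fun n : ℕ => (1 + (n : ℝ)⁻¹ • a) ^ n) Filter.atTop
      (nhds (ContinuousMap.comp ⟨Real.exp, Real.continuous_exp⟩ a)) := by
  rw [tendsto_iff_norm_sub_tendsto_zero]
  refine squeeze_zero' (Filter.Eventually.of_forall fun _ => norm_nonneg _) ?_
    (tendsto_const_div_atTop_nhds_zero_nat (‖a‖ ^ 2 * Real.exp ‖a‖))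
  filter_upwards [Filter.eventually_gt_atTop 0, Filter.eventually_ge_atTop ⌈‖a‖⌉₊] with n hn hM
  rw [ContinuousMap.norm_le _ (by positivity)]
  intro y
  have := abs_one_add_div_pow_sub_exp_le hn (a.norm_coe_le_norm y) (Nat.ceil_le.1 hM)
  simpa [div_eq_inv_mul] using this

/-- The function `x ↦ exp (t xᵢ)` on `X`. -/
noncomputable def expCoord (X : Set (Fin d → ℝ)) (i : Fin d) (t : ℝ) : C(X, ℝ) :=
  ⟨fun x => Real.exp (t * x.1 i),
    Real.continuous_exp.comp (continuous_const.mul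
      ((continuous_apply i).comp continuous_subtype_val))⟩

variable [CompactSpace X]

theorem add_const_mem_closure {u : C(X, ℝ)} (hu : u ∈ closure (ttReachable X)) (c : ℝ) :
    u + ContinuousMap.const X c ∈ closure (ttReachable X) :=
  map_mem_closure (f := fun u : C(X, ℝ) => u + ContinuousMap.const X c) (by fun_prop) hu
    fun _ hv => add_const_mem_ttReachable hv c

theorem mul_expCoord_mem_closure {u : C(X, ℝ)} (hu : u ∈ closure (ttReachable X)) (i : Fin d)
    (t : ℝ) : u * expCoord X i t ∈ closure (ttReachable X) := by
  refine map_mem_closure (f := fun u : C(X, ℝ) => u * expCoord X i t)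
    (t := closure (ttReachable X)) (by fun_prop) hu ?_ |> fun h => by rwa [closure_closure] at h
  intro v hv
  let a : C(X, ℝ) := ⟨fun x => t * x.1 i,
    continuous_const.mul ((continuous_apply i).comp continuous_subtype_val)⟩
  refine mem_closure_of_tendsto ((tendsto_one_add_div_pow_continuousMap a).const_mul v)
    (Filter.Eventually.of_forall fun n => ?_)
  have hpow : ∀ m : ℕ, v * (1 + (n : ℝ)⁻¹ • a) ^ m ∈ ttReachable X := by
    intro m
    induction m with
    | zero => simpa using hv
    | succ m ih =>
      rw [pow_succ, ← mul_assoc]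
      exact mul_one_add_mem_ttReachable ih i ((n : ℝ)⁻¹ * t) fun x => by simp [a, mul_assoc]
  exact hpow n

/-- Products of coordinate exponentials are invertible, and both they and their inverses act by
multiplication on the closure of the reachable functions. -/
theorem exists_inverse_of_mem_closure_expCoord {h : C(X, ℝ)}
    (hh : h ∈ Submonoid.closure {e | ∃ i t, e = expCoord X i t}) :
    ∃ h' : C(X, ℝ), h' * h = 1 ∧
      (∀ u ∈ closure (ttReachable X), u * h ∈ closure (ttReachable X)) ∧
      ∀ u ∈ closure (ttReachable X), u * h' ∈ closure (ttReachable X) := by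
  induction hh using Submonoid.closure_induction with
  | mem e he =>
    obtain ⟨i, t, rfl⟩ := he
    refine ⟨expCoord X i (-t), ?_, fun u hu => mul_expCoord_mem_closure hu i t,
      fun u hu => mul_expCoord_mem_closure hu i (-t)⟩
    ext x
    simp [expCoord, ← Real.exp_add]
  | one => exact ⟨1, by simp⟩
  | mul g h _ _ hg hh =>
    obtain ⟨g', hg1, hg2, hg3⟩ := hg
    obtain ⟨h', hh1, hh2, hh3⟩ := hh
    refine ⟨g' * h', by rw [mul_mul_mul_comm, hg1, hh1, one_mul], fun u hu => ?_, fun u hu => ?_⟩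
    · rw [← mul_assoc]
      exact hh2 _ (hg2 u hu)
    · rw [← mul_assoc]
      exact hh3 _ (hg3 u hu)

theorem adjoin_expCoord_subset_closure :
    (Algebra.adjoin ℝ {e | ∃ i t, e = expCoord X i t} : Set C(X, ℝ)) ⊆
      closure (ttReachable X) := by
  intro g hg
  have hg' : g ∈ Submodule.span ℝ
      (Submonoid.closure {e | ∃ i t, e = expCoord X i t} : Set C(X, ℝ)) := by
    rw [← Algebra.adjoin_eq_span]
    exact hg
  suffices H : ∀ c : ℝ, ∀ u ∈ closure (ttReachable X), u + c • g ∈ closure (ttReachable X) by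
    simpa using H 1 0 (subset_closure zero_mem_ttReachable)
  clear hg
  induction hg' using Submodule.span_induction with
  | mem h hh =>
    intro c u hu
    obtain ⟨h', h1, h2, h3⟩ := exists_inverse_of_mem_closure_expCoord hh
    have : u + c • h = (u * h' + ContinuousMap.const X c) * h := by
      rw [add_mul, mul_assoc, h1, mul_one]
      ext x
      simp
    rw [this]
    exact h2 _ (add_const_mem_closure (h3 u hu) c)
  | zero => simp
  | add g h _ _ hg hh =>
    intro c u hu
    rw [smul_add, ← add_assoc]
    exact hh c _ (hg c u hu)
  | smul r g _ hg =>
    intro c u hu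
    rw [smul_smul]
    exact hg _ u hu

theorem dense_ttReachable : Dense (ttReachable X) := by
  intro f
  have hsep : (Algebra.adjoin ℝ {e | ∃ i t, e = expCoord X i t} :
      Subalgebra ℝ C(X, ℝ)).SeparatesPoints := by
    intro x y hxy
    obtain ⟨i, hi⟩ := Function.ne_iff.1 (Subtype.coe_ne_coe.2 hxy)
    exact ⟨_, ⟨expCoord X i 1, Algebra.subset_adjoin ⟨i, 1, rfl⟩, rfl⟩, by simpa [expCoord] using hi⟩
  have hf := ContinuousMap.continuousMap_mem_subalgebra_closure_of_separatesPoints _ hsep f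
  exact closure_minimal adjoin_expCoord_subset_closure isClosed_closure hf

end Reachable

/-- Universality in C(𝒳): compositional tensor trains of width d + 1
with affine factors and ranks bounded by (d+1, 2, …, 2, 1), lift 𝔏(x) = (0, x) and
retraction 𝔑(y) = y₁, are dense in the continuous functions on a compact set 𝒳 for
the supremum norm. -/
theorem stmt_12 (d : ℕ) (X : Set (Fin d → ℝ)) (hX : IsCompact X)
    (f : (Fin d → ℝ) → ℝ) (hf : ContinuousOn f X) (ε : ℝ) (hε : 0 < ε) :
    ∃ (L : ℕ) (ψ : ℕ → (Fin (d + 1) → ℝ) → Fin (d + 1) → ℝ),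
      (∀ ℓ < L, HasTTAffine (d + 1) (ψ ℓ) 2) ∧
      ∀ x ∈ X,
        |f x - ((List.range L).foldl (fun y ℓ => y + ψ ℓ y) (Fin.cons 0 x)) 0| ≤ ε := by
  have : CompactSpace X := isCompact_iff_compactSpace.1 hX
  obtain ⟨u, ⟨L, ψ, hψ, hL⟩, hu⟩ :=
    dense_ttReachable.exists_dist_lt (⟨X.domRestrict f, hf.domRestrict⟩ : C(X, ℝ)) hε
  refine ⟨L, ψ, hψ, fun x hx => ?_⟩
  have hdist := (ContinuousMap.dist_apply_le_dist (⟨x, hx⟩ : X)).trans hu.le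
  rw [Real.dist_eq] at hdist
  rw [hL ⟨x, hx⟩]
  exact hdist
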